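/- Let X₁, X₂, … be a stationary m-dependent sequence of random variables with E[X_i] = 0 and, for some δ > 0, E[|X_i|^{2+δ}] < ∞. Denote S_n = X₁ + ⋯ + X_n. Then lim_{n→∞} E[S_n²]/n = σ² = E[X₁²] + 2 Σ_{i=2}^{m+1} E[X₁ X_i] < ∞, and if σ ≠ 0 then S_n/(σ√n) converges in distribution to the standard normal N(0,1). -/

import Mathlib

open MeasureTheory ProbabilityTheory Filter Finset

/-- A real-valued sequence of random variables is stationary: all joint
distributions are translation invariant. -/
def StationarySeq {Ω : Type*} [MeasurableSpace Ω] (μ : Measure Ω)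
    (X : ℕ → Ω → ℝ) : Prop :=
  ∀ k : ℕ, Measure.map (fun ω (i : ℕ) => X (i + k) ω) μ
    = Measure.map (fun ω (i : ℕ) => X i ω) μ

/-- `m`-dependence: the past `(X_0,…,X_i)` is independent of `(X_{i+k}, X_{i+k+1}, …)`
whenever `k > m`. -/
def MDependentSeq {Ω : Type*} [MeasurableSpace Ω] (μ : Measure Ω)
    (m : ℕ) (X : ℕ → Ω → ℝ) : Prop :=
  ∀ i k : ℕ, m < k →
    IndepFun (fun ω (j : Fin (i + 1)) => X j ω) (fun ω (j : ℕ) => X (i + k + j) ω) μ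

open scoped Topology

section Sequences

variable {Ω : Type*} [MeasurableSpace Ω] {μ : Measure Ω} {X : ℕ → Ω → ℝ}

/-- A measurable functional of a shifted stationary sequence has the law of the functional
of the original sequence. -/
lemma StationarySeq.identDistrib {β : Type*} [MeasurableSpace β] (hstat : StationarySeq μ X)
    (hmeas : ∀ i, Measurable (X i)) (k : ℕ) {g : (ℕ → ℝ) → β} (hg : Measurable g) :
    IdentDistrib (fun ω => g (fun i => X (i + k) ω)) (fun ω => g (fun i => X i ω)) μ μ := by
  have h : IdentDistrib (fun ω (i : ℕ) => X (i + k) ω) (fun ω (i : ℕ) => X i ω) μ μ :=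
    ⟨(measurable_pi_lambda _ fun i => hmeas _).aemeasurable,
      (measurable_pi_lambda _ fun i => hmeas _).aemeasurable, hstat k⟩
  exact h.comp hg

lemma StationarySeq.integral_mul_add (hstat : StationarySeq μ X)
    (hmeas : ∀ i, Measurable (X i)) (i j k : ℕ) :
    ∫ ω, X (i + k) ω * X (j + k) ω ∂μ = ∫ ω, X i ω * X j ω ∂μ :=
  (hstat.identDistrib hmeas k (g := fun x => x i * x j) (by fun_prop)).integral_eq

/-- Finite sums over a past and a future separated by a gap larger than `m` are independent. -/
lemma MDependentSeq.indepFun_sum {m : ℕ} (hdep : MDependentSeq μ m X) {ι κ : Type*}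
    (A : Finset ι) (a : ι → ℕ) (B : Finset κ) (b : κ → ℕ) (i : ℕ)
    (hA : ∀ x ∈ A, a x ≤ i) (hB : ∀ y ∈ B, i + m < b y) :
    IndepFun (fun ω => ∑ x ∈ A, X (a x) ω) (fun ω => ∑ y ∈ B, X (b y) ω) μ := by
  have hφ : Measurable (fun z : Fin (i + 1) → ℝ =>
      ∑ x ∈ A, if h : a x < i + 1 then z ⟨a x, h⟩ else 0) := by
    refine Finset.measurable_fun_sum _ fun x _ => ?_
    split_ifs <;> fun_prop
  have hψ : Measurable (fun z : ℕ → ℝ => ∑ y ∈ B, z (b y - (i + (m + 1)))) := by fun_prop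
  convert! (hdep i (m + 1) m.lt_succ_self).comp hφ hψ using 1
  · ext ω
    refine Finset.sum_congr rfl fun x hx => ?_
    simp [Nat.lt_succ_of_le (hA x hx)]
  · ext ω
    refine Finset.sum_congr rfl fun y hy => ?_
    have := hB y hy
    simp only
    congr 1
    lia

lemma MDependentSeq.integral_mul_eq_zero {m : ℕ} (hdep : MDependentSeq μ m X)
    (hmeas : ∀ i, Measurable (X i)) (hmean : ∀ i, ∫ ω, X i ω ∂μ = 0) {i j : ℕ}
    (hij : i + m < j) : ∫ ω, X i ω * X j ω ∂μ = 0 := by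
  have h := hdep.indepFun_sum {i} id {j} id i (by simp) (by simpa using hij)
  simp only [id, Finset.sum_singleton] at h
  rw [h.integral_fun_mul_eq_mul_integral (hmeas i).aestronglyMeasurable
    (hmeas j).aestronglyMeasurable, hmean, zero_mul]

lemma integral_sum_sq (hL2 : ∀ i, MemLp (X i) 2 μ) (A : Finset ℕ) :
    ∫ ω, (∑ i ∈ A, X i ω) ^ 2 ∂μ = ∑ i ∈ A, ∑ j ∈ A, ∫ ω, X i ω * X j ω ∂μ := by
  have hint (i j : ℕ) : Integrable (fun ω => X i ω * X j ω) μ := (hL2 i).integrable_mul (hL2 j)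
  simp_rw [sq, Finset.sum_mul_sum]
  rw [integral_finsetSum _ fun i _ => integrable_finsetSum _ fun j _ => hint i j]
  exact Finset.sum_congr rfl fun i _ => integral_finsetSum _ fun j _ => hint i j

/-- The variance of a sum of `N` terms of a stationary `m`-dependent sequence is `O(N)`. -/
lemma integral_sum_sq_le {m : ℕ} (hmeas : ∀ i, Measurable (X i))
    (hstat : StationarySeq μ X) (hdep : MDependentSeq μ m X)
    (hmean : ∀ i, ∫ ω, X i ω ∂μ = 0) (hL2 : ∀ i, MemLp (X i) 2 μ) (A : Finset ℕ) :
    ∫ ω, (∑ i ∈ A, X i ω) ^ 2 ∂μ ≤ #A * ((2 * m + 1) * ∫ ω, X 0 ω ^ 2 ∂μ) := by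
  set r := ∫ ω, X 0 ω ^ 2 ∂μ with hr
  have hr0 : 0 ≤ r := integral_nonneg fun ω => sq_nonneg _
  have hsq (i : ℕ) : ∫ ω, X i ω ^ 2 ∂μ = r := by
    have := hstat.integral_mul_add hmeas 0 0 i
    simpa [hr, sq] using this
  have hcov (i j : ℕ) : ∫ ω, X i ω * X j ω ∂μ ≤ r := by
    have hi := (hL2 i).integrable_sq
    have hj := (hL2 j).integrable_sq
    calc ∫ ω, X i ω * X j ω ∂μ ≤ ∫ ω, (X i ω ^ 2 + X j ω ^ 2) / 2 ∂μ :=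
          integral_mono ((hL2 i).integrable_mul (hL2 j)) ((hi.add hj).div_const 2)
            fun ω => by simp only; nlinarith [sq_nonneg (X i ω - X j ω)]
      _ = r := by rw [integral_div, integral_add hi hj, hsq, hsq]; ring
  rw [integral_sum_sq hL2, ← nsmul_eq_mul]
  refine Finset.sum_le_card_nsmul _ _ _ fun i _ => ?_
  have hcard : (#(A.filter fun j => j ∈ Finset.Icc (i - m) (i + m)) : ℝ) ≤ 2 * m + 1 := by
    have h : #(A.filter fun j => j ∈ Finset.Icc (i - m) (i + m)) ≤ 2 * m + 1 :=
      (Finset.card_le_card fun j hj => (Finset.mem_filter.1 hj).2).trans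
        (by rw [Nat.card_Icc]; lia)
    exact_mod_cast h
  calc ∑ j ∈ A, ∫ ω, X i ω * X j ω ∂μ
      = ∑ j ∈ A.filter fun j => j ∈ Finset.Icc (i - m) (i + m), ∫ ω, X i ω * X j ω ∂μ := by
        refine (Finset.sum_filter_of_ne fun j _ hne => ?_).symm
        contrapose! hne
        rw [Finset.mem_Icc, not_and_or] at hne
        by_cases h : i + m < j
        · exact hdep.integral_mul_eq_zero hmeas hmean h
        · simp_rw [mul_comm (X i _)]
          exact hdep.integral_mul_eq_zero hmeas hmean (by lia)
    _ ≤ #(A.filter fun j => j ∈ Finset.Icc (i - m) (i + m)) * r := by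
        rw [← nsmul_eq_mul]
        exact Finset.sum_le_card_nsmul _ _ _ fun j _ => hcov i j
    _ ≤ (2 * m + 1) * r := by gcongr

/-- The variance of the partial sums of a stationary `m`-dependent sequence grows linearly. -/
lemma tendsto_integral_sum_range_sq_div {m : ℕ} (hmeas : ∀ i, Measurable (X i))
    (hstat : StationarySeq μ X) (hdep : MDependentSeq μ m X)
    (hmean : ∀ i, ∫ ω, X i ω ∂μ = 0) (hL2 : ∀ i, MemLp (X i) 2 μ) :
    Tendsto (fun n : ℕ => (∫ ω, (∑ i ∈ Finset.range n, X i ω) ^ 2 ∂μ) / n) atTop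
      (𝓝 ((∫ ω, X 0 ω ^ 2 ∂μ) + 2 * ∑ i ∈ Finset.Icc 1 m, ∫ ω, X 0 ω * X i ω ∂μ)) := by
  set c : ℕ → ℝ := fun d => ∫ ω, X 0 ω * X d ω ∂μ with hc
  have hcov (n j : ℕ) (hj : j ∈ Finset.range n) : ∫ ω, X j ω * X n ω ∂μ = c (n - j) := by
    have h := hstat.integral_mul_add hmeas 0 (n - j) j
    rwa [zero_add, Nat.sub_add_cancel (Finset.mem_range.1 hj).le] at h
  have hsq (n : ℕ) : ∫ ω, X n ω * X n ω ∂μ = c 0 := by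
    simpa using hstat.integral_mul_add hmeas 0 0 n
  have hsum (n : ℕ) : ∫ ω, (∑ i ∈ Finset.range n, X i ω) ^ 2 ∂μ
      = ∑ k ∈ Finset.range n, (c 0 + 2 * ∑ d ∈ Finset.Icc 1 k, c d) := by
    induction n with
    | zero => simp
    | succ n ih =>
      have hrefl : ∑ j ∈ Finset.range n, ∫ ω, X j ω * X n ω ∂μ = ∑ d ∈ Finset.Icc 1 n, c d := by
        rw [Finset.sum_congr rfl (hcov n)]
        refine Finset.sum_bij' (fun j _ => n - j) (fun d _ => n - d) ?_ ?_ ?_ ?_ ?_ <;>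
          simp only [Finset.mem_range, Finset.mem_Icc] <;> intros <;> first | rfl | lia
      rw [Finset.sum_range_succ, ← ih, integral_sum_sq hL2, integral_sum_sq hL2,
        Finset.sum_range_succ]
      simp_rw [Finset.sum_range_succ _ n, Finset.sum_add_distrib]
      rw [hrefl, hsq, ← hrefl]
      simp_rw [mul_comm (X n _)]
      ring
  have hlim : Tendsto (fun k => c 0 + 2 * ∑ d ∈ Finset.Icc 1 k, c d) atTop
      (𝓝 (c 0 + 2 * ∑ d ∈ Finset.Icc 1 m, c d)) := by
    refine tendsto_const_nhds.congr' ?_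
    filter_upwards [eventually_ge_atTop m] with k hk
    congr 2
    refine Finset.sum_subset (Finset.Icc_subset_Icc_right hk) fun d hd hd' => ?_
    simp only [Finset.mem_Icc] at hd hd'
    exact hdep.integral_mul_eq_zero hmeas hmean (by lia)
  have h0 : ∫ ω, X 0 ω ^ 2 ∂μ = c 0 := by simp [hc, sq]
  rw [h0]
  refine hlim.cesaro.congr fun n => ?_
  rw [hsum, div_eq_inv_mul]

end Sequences

section CharFun

variable {Ω : Type*} [MeasurableSpace Ω] {μ : Measure Ω} [IsProbabilityMeasure μ]

lemma norm_charFun_map_sub_le {U V : Ω → ℝ} (hU : MemLp U 2 μ) (hV : MemLp V 2 μ) (t : ℝ) :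
    ‖charFun (μ.map U) t - charFun (μ.map V) t‖ ≤ |t| * √(∫ ω, (U ω - V ω) ^ 2 ∂μ) := by
  have hD : MemLp (fun ω => |U ω - V ω|) 2 μ := (hU.sub hV).abs
  have hint {W : Ω → ℝ} (hW : MemLp W 2 μ) :
      Integrable (fun ω => Complex.exp (t * W ω * Complex.I)) μ := by
    have hWm := hW.aestronglyMeasurable.aemeasurable
    refine Integrable.of_bound (C := 1) ?_ (ae_of_all _ fun ω => ?_)
    · exact AEMeasurable.aestronglyMeasurable (by fun_prop)
    · rw [← Complex.ofReal_mul, Complex.norm_exp_ofReal_mul_I]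
  have hpt (x y : ℝ) :
      ‖Complex.exp (t * x * Complex.I) - Complex.exp (t * y * Complex.I)‖ ≤ |t| * |x - y| := by
    have h : Complex.exp (t * x * Complex.I) - Complex.exp (t * y * Complex.I)
        = Complex.exp ((t * y : ℝ) * Complex.I)
          * (Complex.exp (Complex.I * (t * (x - y) : ℝ)) - 1) := by
      rw [mul_sub, ← Complex.exp_add, mul_one]
      congr 2 <;> push_cast <;> ring
    rw [h, norm_mul, Complex.norm_exp_ofReal_mul_I, one_mul, ← abs_mul]
    exact Real.norm_exp_I_mul_ofReal_sub_one_le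
  have hmap {W : Ω → ℝ} (hW : MemLp W 2 μ) :
      charFun (μ.map W) t = ∫ ω, Complex.exp (t * W ω * Complex.I) ∂μ := by
    rw [charFun_apply_real, integral_map hW.aestronglyMeasurable.aemeasurable]
    exact Measurable.aestronglyMeasurable (by fun_prop)
  calc ‖charFun (μ.map U) t - charFun (μ.map V) t‖
      = ‖∫ ω, (Complex.exp (t * U ω * Complex.I) - Complex.exp (t * V ω * Complex.I)) ∂μ‖ := by
        rw [hmap hU, hmap hV, integral_sub (hint hU) (hint hV)]
    _ ≤ ∫ ω, |t| * |U ω - V ω| ∂μ :=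
        norm_integral_le_of_norm_le ((hD.integrable one_le_two).const_mul _)
          (ae_of_all _ fun ω => hpt _ _)
    _ = |t| * ∫ ω, |U ω - V ω| ∂μ := integral_const_mul _ _
    _ ≤ |t| * √(∫ ω, (U ω - V ω) ^ 2 ∂μ) := by
        gcongr
        refine Real.le_sqrt_of_sq_le ?_
        have h := variance_nonneg (fun ω => |U ω - V ω|) μ
        rw [variance_eq_sub hD] at h
        simpa [sq_abs] using h

lemma tendsto_charFun_map_pow {B : Ω → ℝ} (hB : Measurable B) (h0 : ∫ ω, B ω ∂μ = 0) {v : ℝ}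
    (hv : 0 < v) (hBv : ∫ ω, B ω ^ 2 ∂μ = v) {ℓ : ℝ} (hℓ : 0 < ℓ) (t : ℝ) :
    Tendsto (fun k : ℕ => charFun (μ.map B) ((√(k * ℓ))⁻¹ * t) ^ k) atTop
      (𝓝 (Complex.exp (-(t ^ 2 * (v / ℓ) / 2) : ℝ))) := by
  have hsv : √v ≠ 0 := (Real.sqrt_pos.2 hv).ne'
  have h := tendsto_charFun_inv_sqrt_mul_pow (P := μ) (X := fun ω => (√v)⁻¹ * B ω)
    (hB.const_mul _).aemeasurable (by rw [integral_const_mul, h0, mul_zero])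
    (by
      simp only [Pi.pow_apply, mul_pow, integral_const_mul, hBv, inv_pow, Real.sq_sqrt hv.le]
      exact inv_mul_cancel₀ hv.ne') (√v * (√ℓ)⁻¹ * t)
  have hlim : Complex.exp (-((√v * (√ℓ)⁻¹ * t : ℝ) : ℂ) ^ 2 / 2)
      = Complex.exp (-(t ^ 2 * (v / ℓ) / 2) : ℝ) := by
    rw [← Complex.ofReal_pow, mul_pow, mul_pow, inv_pow, Real.sq_sqrt hv.le, Real.sq_sqrt hℓ.le]
    congr 1
    push_cast
    ring
  rw [hlim] at h
  refine h.congr fun k => ?_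
  rw [charFun_map_mul_comp hB.aemeasurable, Real.sqrt_mul k.cast_nonneg, mul_inv]
  congr 2
  field_simp

end CharFun

/-- A limit interchange: `f` is approximated by the rows of a double array. -/
lemma tendsto_of_norm_sub_le {E : Type*} [SeminormedAddCommGroup E] {f : ℕ → E} {a : E}
    {g : ℕ → ℕ → E} {α : ℕ → E} {b : ℕ → ℕ → ℝ} {β : ℕ → ℝ}
    (hg : ∀ᶠ p in atTop, Tendsto (g p) atTop (𝓝 (α p))) (hα : Tendsto α atTop (𝓝 a))
    (hb : ∀ᶠ p in atTop, Tendsto (b p) atTop (𝓝 (β p))) (hβ : Tendsto β atTop (𝓝 0))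
    (hfg : ∀ᶠ p in atTop, ∀ᶠ n in atTop, ‖f n - g p n‖ ≤ b p n) :
    Tendsto f atTop (𝓝 a) := by
  rw [Metric.tendsto_nhds]
  intro ε hε
  obtain ⟨p, hgp, hαp, hbp, hβp, hp⟩ := (hg.and <| ((Metric.tendsto_nhds.1 hα) (ε / 3)
    (by positivity)).and <| hb.and <| (hβ.eventually_lt_const
      (show (0 : ℝ) < ε / 3 by positivity)).and hfg).exists
  filter_upwards [hp, hbp.eventually_lt_const hβp,
    (Metric.tendsto_nhds.1 hgp) (ε / 3) (by positivity)] with n h1 h2 h3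
  rw [← dist_eq_norm] at h1
  linarith [dist_triangle4 (f n) (g p n) (α p) a]

section Blocks

variable {Ω : Type*} {X : ℕ → Ω → ℝ}

/-- The sum of the first `k` blocks of length `p`, consecutive blocks being separated by gaps
of length `m`. -/
def blockSum (X : ℕ → Ω → ℝ) (p m k : ℕ) (ω : Ω) : ℝ :=
  ∑ j ∈ Finset.range k, ∑ r ∈ Finset.range p, X (j * (p + m) + r) ω

lemma sum_range_mul_eq_blockSum_add (p m k : ℕ) (ω : Ω) :
    ∑ i ∈ Finset.range (k * (p + m)), X i ω = blockSum X p m k ω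
      + ∑ j ∈ Finset.range k, ∑ r ∈ Finset.range m, X (j * (p + m) + p + r) ω := by
  induction k with
  | zero => simp [blockSum]
  | succ k ih =>
    rw [add_mul, one_mul, Finset.sum_range_add, ih, Finset.sum_range_add]
    simp only [blockSum, Finset.sum_range_succ, add_assoc]
    ring

variable [MeasurableSpace Ω] {μ : Measure Ω}

lemma memLp_blockSum (hL2 : ∀ i, MemLp (X i) 2 μ) (p m k : ℕ) :
    MemLp (blockSum X p m k) 2 μ :=
  memLp_finsetSum _ fun _ _ => memLp_finsetSum _ fun _ _ => hL2 _

/-- Discarding the gaps and the incomplete last block costs little in mean square. -/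
lemma integral_sum_sub_blockSum_sq_le {m : ℕ} (hmeas : ∀ i, Measurable (X i))
    (hstat : StationarySeq μ X) (hdep : MDependentSeq μ m X)
    (hmean : ∀ i, ∫ ω, X i ω ∂μ = 0) (hL2 : ∀ i, MemLp (X i) 2 μ) {p : ℕ} (hp : 0 < p) (n : ℕ) :
    ∫ ω, (∑ i ∈ Finset.range n, X i ω - blockSum X p m (n / (p + m)) ω) ^ 2 ∂μ ≤
      2 * ((2 * m + 1) * ∫ ω, X 0 ω ^ 2 ∂μ) * ((n / (p + m) : ℕ) * m + (p + m)) := by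
  set k := n / (p + m)
  set C := (2 * m + 1) * ∫ ω, X 0 ω ^ 2 ∂μ
  have hC0 : 0 ≤ C := mul_nonneg (by positivity) (integral_nonneg fun ω => sq_nonneg _)
  have hkn : k * (p + m) ≤ n := Nat.div_mul_le_self n (p + m)
  have hnk : n < k * (p + m) + (p + m) := Nat.lt_div_mul_add (by lia)
  set e : ℕ × ℕ → ℕ := fun x => x.1 * (p + m) + p + x.2 with he
  set A := (Finset.range k ×ˢ Finset.range m).image e with hA
  have hinj : Set.InjOn e (Finset.range k ×ˢ Finset.range m : Finset (ℕ × ℕ)) := by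
    rintro ⟨j, r⟩ hx ⟨j', r'⟩ hy hxy
    simp only [Finset.coe_product, Finset.coe_range, Set.mem_prod, Set.mem_Iio] at hx hy
    have hdiv (a b : ℕ) (hb : b < m) : (a * (p + m) + p + b) / (p + m) = a := by
      rw [add_assoc, mul_comm, Nat.mul_add_div (by lia), Nat.div_eq_of_lt (by lia), add_zero]
    have hj : j = j' := by
      rw [← hdiv j r hx.2, ← hdiv j' r' hy.2]
      exact congrArg (· / (p + m)) hxy
    subst hj
    simpa [he] using hxy
  have hsplit (ω : Ω) : ∑ i ∈ Finset.range n, X i ω - blockSum X p m k ω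
      = ∑ i ∈ A, X i ω + ∑ i ∈ Finset.Ico (k * (p + m)) n, X i ω := by
    rw [← Finset.sum_range_add_sum_Ico _ hkn, sum_range_mul_eq_blockSum_add, hA,
      Finset.sum_image hinj, Finset.sum_product]
    ring
  have hmem (s : Finset ℕ) : MemLp (fun ω => ∑ i ∈ s, X i ω) 2 μ :=
    memLp_finsetSum _ fun i _ => hL2 i
  have hcA : (#A : ℝ) ≤ k * m := by
    have h : #A ≤ k * m := Finset.card_image_le.trans (by simp)
    exact_mod_cast h
  have hcI : (#(Finset.Ico (k * (p + m)) n) : ℝ) ≤ p + m := by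
    have h : #(Finset.Ico (k * (p + m)) n) ≤ p + m := by rw [Nat.card_Ico]; lia
    exact_mod_cast h
  have hbd (s : Finset ℕ) := integral_sum_sq_le hmeas hstat hdep hmean hL2 s
  calc ∫ ω, (∑ i ∈ Finset.range n, X i ω - blockSum X p m k ω) ^ 2 ∂μ
      ≤ ∫ ω, 2 * ((∑ i ∈ A, X i ω) ^ 2 + (∑ i ∈ Finset.Ico (k * (p + m)) n, X i ω) ^ 2) ∂μ := by
        simp_rw [hsplit]
        exact integral_mono ((hmem _).add (hmem _)).integrable_sq
          (((hmem _).integrable_sq.add (hmem _).integrable_sq).const_mul 2) fun ω => add_sq_le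
    _ = 2 * (∫ ω, (∑ i ∈ A, X i ω) ^ 2 ∂μ
          + ∫ ω, (∑ i ∈ Finset.Ico (k * (p + m)) n, X i ω) ^ 2 ∂μ) := by
        rw [integral_const_mul, integral_add (hmem _).integrable_sq (hmem _).integrable_sq]
    _ ≤ 2 * (k * m * C + (p + m) * C) := by
        gcongr
        · exact (hbd A).trans (by gcongr)
        · exact (hbd _).trans (by gcongr)
    _ = 2 * C * (k * m + (p + m)) := by ring

/-- The blocks are independent and identically distributed. -/
lemma charFun_map_blockSum [IsProbabilityMeasure μ] {m : ℕ} (hmeas : ∀ i, Measurable (X i))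
    (hstat : StationarySeq μ X) (hdep : MDependentSeq μ m X) {p : ℕ} (hp : 0 < p) (k : ℕ)
    (t : ℝ) :
    charFun (μ.map (blockSum X p m k)) t
      = charFun (μ.map fun ω => ∑ i ∈ Finset.range p, X i ω) t ^ k := by
  induction k with
  | zero =>
    have h : blockSum X p m 0 = fun _ => 0 := by ext; simp [blockSum]
    simp [h]
  | succ k ih =>
    have hind : IndepFun (blockSum X p m k)
        (fun ω => ∑ r ∈ Finset.range p, X (k * (p + m) + r) ω) μ := by
      rcases k.eq_zero_or_pos with rfl | hk
      · have h : blockSum X p m 0 = fun _ => 0 := by ext; simp [blockSum]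
        rw [h]
        exact indepFun_const_left _ _
      · have h := hdep.indepFun_sum (Finset.range k ×ˢ Finset.range p)
          (fun x => x.1 * (p + m) + x.2) (Finset.range p) (fun r => k * (p + m) + r)
          (k * (p + m) - m - 1) ?_ ?_
        · simp only [Finset.sum_product] at h
          exact h
        · rintro ⟨j, r⟩ hx
          simp only [Finset.mem_product, Finset.mem_range] at hx
          have : (j + 1) * (p + m) ≤ k * (p + m) := Nat.mul_le_mul_right _ hx.1
          have : (j + 1) * (p + m) = j * (p + m) + (p + m) := by ring
          simp only
          lia
        · intro r _
          have : 1 * (p + m) ≤ k * (p + m) := Nat.mul_le_mul_right _ hk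
          lia
    have hsucc : blockSum X p m (k + 1)
        = fun ω => blockSum X p m k ω + ∑ r ∈ Finset.range p, X (k * (p + m) + r) ω := by
      ext ω
      simp [blockSum, Finset.sum_range_succ]
    have hid := (hstat.identDistrib hmeas (k * (p + m))
      (g := fun x => ∑ r ∈ Finset.range p, x r) (by fun_prop)).map_eq
    simp only [add_comm _ (k * (p + m))] at hid
    have hbm : Measurable (blockSum X p m k) := by unfold blockSum; fun_prop
    rw [hsucc, hind.charFun_map_fun_add_eq_mul hbm.aemeasurable
      (by fun_prop), Pi.mul_apply, ih, hid, pow_succ]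

/-- Comparison of the characteristic function of a normalized partial sum with that of a
normalized sum of independent blocks. -/
lemma norm_charFun_sum_sub_charFun_pow_le [IsProbabilityMeasure μ] {m : ℕ}
    (hmeas : ∀ i, Measurable (X i)) (hstat : StationarySeq μ X) (hdep : MDependentSeq μ m X)
    (hmean : ∀ i, ∫ ω, X i ω ∂μ = 0) (hL2 : ∀ i, MemLp (X i) 2 μ) {p : ℕ} (hp : 0 < p) {n : ℕ}
    (hn : p + m ≤ n) (t : ℝ) :
    ‖charFun (μ.map fun ω => ∑ i ∈ Finset.range n, X i ω) ((√n)⁻¹ * t)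
      - charFun (μ.map fun ω => ∑ i ∈ Finset.range p, X i ω)
          ((√((n / (p + m) : ℕ) * ((p + m : ℕ) : ℝ)))⁻¹ * t) ^ (n / (p + m))‖
      ≤ |t| * √(6 * ((2 * m + 1) * ∫ ω, X 0 ω ^ 2 ∂μ)
        * (m / (p + m : ℕ) + 1 / (n / (p + m) : ℕ))) := by
  have hk : 0 < n / (p + m) := Nat.div_pos hn (by lia)
  have hkn : n / (p + m) * (p + m) ≤ n := Nat.div_mul_le_self n (p + m)
  have hnk : n < n / (p + m) * (p + m) + (p + m) := Nat.lt_div_mul_add (by lia)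
  have herr := integral_sum_sub_blockSum_sq_le hmeas hstat hdep hmean hL2 hp n
  have hbd := integral_sum_sq_le hmeas hstat hdep hmean hL2 (Finset.range n)
  rw [Finset.card_range] at hbd
  generalize n / (p + m) = k at *
  set C := (2 * m + 1) * ∫ ω, X 0 ω ^ 2 ∂μ
  have hC0 : 0 ≤ C := mul_nonneg (by positivity) (integral_nonneg fun ω => sq_nonneg _)
  have hL : 0 < p + m := by lia
  have hLc : ((p + m : ℕ) : ℝ) = p + m := by push_cast; rfl
  rw [← hLc] at herr
  have hkn' : (k : ℝ) * (p + m : ℕ) ≤ n := by exact_mod_cast hkn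
  have hnk' : (n : ℝ) ≤ k * (p + m : ℕ) + (p + m : ℕ) := by exact_mod_cast hnk.le
  have hℓ : (0 : ℝ) < (p + m : ℕ) := by exact_mod_cast hL
  have hk0 : (0 : ℝ) < k := by exact_mod_cast hk
  generalize ((p + m : ℕ) : ℝ) = ℓ at *
  set S : Ω → ℝ := fun ω => ∑ i ∈ Finset.range n, X i ω
  set Y : Ω → ℝ := blockSum X p m k
  have hS2 : MemLp S 2 μ := memLp_finsetSum _ fun i _ => hL2 i
  have hY2 : MemLp Y 2 μ := memLp_blockSum hL2 p m k
  have hkℓ : 0 < k * ℓ := mul_pos hk0 hℓ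
  have hn0 : (0 : ℝ) < n := hkℓ.trans_le hkn'
  set a := (√n)⁻¹
  set b := (√(k * ℓ))⁻¹ with hb
  have hb2 : b ^ 2 * (k * m + ℓ) = m / ℓ + 1 / k := by
    rw [hb, inv_pow, Real.sq_sqrt hkℓ.le]
    field_simp
  have hab : (a - b) ^ 2 * n ≤ 1 / k := by
    have hsn : √n * a = 1 := mul_inv_cancel₀ (Real.sqrt_pos.2 hn0).ne'
    have hq1 : 1 ≤ √n * b := by
      rw [hb, ← div_eq_mul_inv, one_le_div (Real.sqrt_pos.2 hkℓ)]
      exact Real.sqrt_le_sqrt hkn'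
    have hq2 : (√n * b) ^ 2 ≤ 1 + 1 / k := by
      rw [mul_pow, hb, inv_pow, Real.sq_sqrt hkℓ.le, Real.sq_sqrt hn0.le, ← div_eq_mul_inv,
        div_le_iff₀ hkℓ]
      calc (n : ℝ) ≤ k * ℓ + ℓ := hnk'
        _ = (1 + 1 / k) * (k * ℓ) := by field_simp
    have hscale : (a - b) ^ 2 * n = (√n * a - √n * b) ^ 2 := by
      rw [← mul_sub, mul_pow (√(n : ℝ)), Real.sq_sqrt hn0.le, mul_comm]
    rw [hscale, hsn]
    nlinarith
  rw [← charFun_map_blockSum hmeas hstat hdep hp,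
    ← charFun_map_mul_comp hS2.aestronglyMeasurable.aemeasurable,
    ← charFun_map_mul_comp hY2.aestronglyMeasurable.aemeasurable]
  refine (norm_charFun_map_sub_le (hS2.const_mul a) (hY2.const_mul b) t).trans ?_
  gcongr
  have hi1 : Integrable (fun ω => b ^ 2 * (S ω - Y ω) ^ 2) μ :=
    (hS2.sub hY2).integrable_sq.const_mul _
  have hi2 : Integrable (fun ω => (a - b) ^ 2 * S ω ^ 2) μ := hS2.integrable_sq.const_mul _
  calc ∫ ω, (a * S ω - b * Y ω) ^ 2 ∂μ
      ≤ ∫ ω, 2 * (b ^ 2 * (S ω - Y ω) ^ 2 + (a - b) ^ 2 * S ω ^ 2) ∂μ := by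
        refine integral_mono ((hS2.const_mul a).sub (hY2.const_mul b)).integrable_sq
          ((hi1.add hi2).const_mul 2) fun ω => ?_
        have h := add_sq_le (a := b * (S ω - Y ω)) (b := (a - b) * S ω)
        simp only
        calc (a * S ω - b * Y ω) ^ 2 = (b * (S ω - Y ω) + (a - b) * S ω) ^ 2 := by ring
          _ ≤ _ := h
          _ = _ := by ring
    _ = 2 * (b ^ 2 * ∫ ω, (S ω - Y ω) ^ 2 ∂μ + (a - b) ^ 2 * ∫ ω, S ω ^ 2 ∂μ) := by
        rw [integral_const_mul, integral_add hi1 hi2, integral_const_mul, integral_const_mul]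
    _ ≤ 2 * (b ^ 2 * (2 * C * (k * m + ℓ)) + (a - b) ^ 2 * (n * C)) := by gcongr
    _ = 4 * C * (b ^ 2 * (k * m + ℓ)) + 2 * C * ((a - b) ^ 2 * n) := by ring
    _ ≤ 4 * C * (m / ℓ + 1 / k) + 2 * C * (1 / k) := by rw [hb2]; gcongr
    _ ≤ 4 * C * (m / ℓ + 1 / k) + 2 * C * (m / ℓ + 1 / k) := by
        gcongr
        exact le_add_of_nonneg_left (by positivity)
    _ = 6 * C * (m / ℓ + 1 / k) := by ring

end Blocks

section Limit

variable {Ω : Type*} [MeasurableSpace Ω] {μ : Measure Ω} [IsProbabilityMeasure μ]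
  {X : ℕ → Ω → ℝ}

/-- The characteristic functions of the normalized partial sums of a stationary `m`-dependent
sequence converge to a Gaussian characteristic function. -/
lemma tendsto_charFun_map_sum_range {m : ℕ} (hmeas : ∀ i, Measurable (X i))
    (hstat : StationarySeq μ X) (hdep : MDependentSeq μ m X)
    (hmean : ∀ i, ∫ ω, X i ω ∂μ = 0) (hL2 : ∀ i, MemLp (X i) 2 μ) {s : ℝ} (hs : 0 < s)
    (hvar : Tendsto (fun n : ℕ => (∫ ω, (∑ i ∈ Finset.range n, X i ω) ^ 2 ∂μ) / n) atTop (𝓝 s))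
    (t : ℝ) :
    Tendsto (fun n : ℕ => charFun (μ.map fun ω => ∑ i ∈ Finset.range n, X i ω) ((√n)⁻¹ * t))
      atTop (𝓝 (Complex.exp (-(t ^ 2 * s / 2) : ℝ))) := by
  set v : ℕ → ℝ := fun p => ∫ ω, (∑ i ∈ Finset.range p, X i ω) ^ 2 ∂μ
  set C := (2 * m + 1) * ∫ ω, X 0 ω ^ 2 ∂μ
  have hdiv {p : ℕ} (hp : 0 < p) : Tendsto (fun n => n / (p + m)) atTop atTop :=
    Nat.tendsto_div_const_atTop (by lia)
  have hvL : Tendsto (fun p : ℕ => v p / (p + m : ℕ)) atTop (𝓝 s) := by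
    have h := hvar.mul (tendsto_natCast_div_add_atTop (m : ℝ))
    rw [mul_one] at h
    refine h.congr' ?_
    filter_upwards [eventually_gt_atTop 0] with p hp
    have : (p : ℝ) ≠ 0 := by positivity
    push_cast
    field_simp
    rfl
  have hmL : Tendsto (fun p : ℕ => (m : ℝ) / (p + m : ℕ)) atTop (𝓝 0) :=
    tendsto_const_nhds.div_atTop
      (tendsto_natCast_atTop_atTop.comp (tendsto_add_atTop_nat m))
  refine tendsto_of_norm_sub_le
    (g := fun p n => charFun (μ.map fun ω => ∑ i ∈ Finset.range p, X i ω)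
      ((√((n / (p + m) : ℕ) * ((p + m : ℕ) : ℝ)))⁻¹ * t) ^ (n / (p + m)))
    (α := fun p => Complex.exp (-(t ^ 2 * (v p / (p + m : ℕ)) / 2) : ℝ))
    (b := fun p n => |t| * √(6 * C * (m / (p + m : ℕ) + 1 / (n / (p + m) : ℕ))))
    (β := fun p => |t| * √(6 * C * (m / (p + m : ℕ)))) ?_ ?_ ?_ ?_ ?_
  · filter_upwards [eventually_gt_atTop 0, hvL.eventually_const_lt hs] with p hp hvp
    have hℓ : (0 : ℝ) < (p + m : ℕ) := by positivity
    refine (tendsto_charFun_map_pow (by fun_prop) ?_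
      ((div_pos_iff_of_pos_right hℓ).1 hvp) rfl hℓ t).comp (hdiv hp)
    rw [integral_finsetSum _ fun i _ => (hL2 i).integrable one_le_two]
    exact Finset.sum_eq_zero fun i _ => hmean i
  · exact (by fun_prop : Continuous fun x : ℝ =>
      Complex.exp (-(t ^ 2 * x / 2) : ℝ)).continuousAt.tendsto.comp hvL
  · filter_upwards [eventually_gt_atTop 0] with p hp
    have h : Tendsto (fun n : ℕ => (1 : ℝ) / (n / (p + m) : ℕ)) atTop (𝓝 0) :=
      tendsto_const_nhds.div_atTop (tendsto_natCast_atTop_atTop.comp (hdiv hp))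
    have hadd := h.const_add ((m : ℝ) / (p + m : ℕ))
    rw [add_zero] at hadd
    exact ((hadd.const_mul _).sqrt).const_mul _
  · simpa using ((hmL.const_mul (6 * C)).sqrt).const_mul |t|
  · filter_upwards [eventually_gt_atTop 0] with p hp
    filter_upwards [eventually_ge_atTop (p + m)] with n hn
    exact norm_charFun_sum_sub_charFun_pow_le hmeas hstat hdep hmean hL2 hp hn t

end Limit

lemma memLp_two_of_integrable_rpow {Ω : Type*} [MeasurableSpace Ω] {μ : Measure Ω}
    [IsProbabilityMeasure μ] {Y : Ω → ℝ} (hY : Measurable Y) {δ : ℝ} (hδ : 0 < δ)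
    (h : Integrable (fun ω => |Y ω| ^ (2 + δ)) μ) : MemLp Y 2 μ := by
  rw [memLp_two_iff_integrable_sq hY.aestronglyMeasurable]
  refine ((integrable_const (1 : ℝ)).add h).mono' (hY.pow_const 2).aestronglyMeasurable
    (ae_of_all _ fun ω => ?_)
  rw [Real.norm_of_nonneg (sq_nonneg _), ← sq_abs, Pi.add_apply]
  have h0 := abs_nonneg (Y ω)
  rcases le_total |Y ω| 1 with h1 | h1
  · exact (pow_le_one₀ h0 h1).trans (le_add_of_nonneg_right (by positivity))
  · rw [← Real.rpow_two]
    exact (Real.rpow_le_rpow_of_exponent_le h1 (by linarith)).trans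
      (le_add_of_nonneg_left zero_le_one)

/-- CLT for stationary `m`-dependent zero-mean sequences with a finite `(2+δ)`-moment:
`E[S_n²]/n → σ² = E[X₁²] + 2 Σ_{i=2}^{m+1} E[X₁ X_i] < ∞`, and if `σ ≠ 0` then
`S_n/(σ√n)` converges in distribution to `N(0,1)`. -/
theorem m_dependent_clt
    {Ω : Type*} [MeasurableSpace Ω] (μ : Measure Ω) [IsProbabilityMeasure μ]
    (m : ℕ) (X : ℕ → Ω → ℝ)
    (hmeas : ∀ i, Measurable (X i))
    (hstat : StationarySeq μ X)
    (hdep : MDependentSeq μ m X)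
    (hmean : ∀ i, (∫ ω, X i ω ∂μ) = 0)
    (hmom : ∃ δ : ℝ, 0 < δ ∧ ∀ i, Integrable (fun ω => |X i ω| ^ ((2 : ℝ) + δ)) μ)
    (σ2 : ℝ)
    (hσ2 : σ2 = (∫ ω, (X 0 ω) ^ 2 ∂μ) + 2 * ∑ i ∈ Finset.Icc 1 m, ∫ ω, X 0 ω * X i ω ∂μ) :
    Tendsto (fun n : ℕ => (∫ ω, (∑ i ∈ Finset.range n, X i ω) ^ 2 ∂μ) / n)
        atTop (nhds σ2)
    ∧ (Real.sqrt σ2 ≠ 0 →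
        ∀ t : ℝ, Tendsto (fun n : ℕ =>
            (μ {ω | (∑ i ∈ Finset.range n, X i ω) / (Real.sqrt σ2 * Real.sqrt n) ≤ t}).toReal)
          atTop (nhds ((gaussianReal 0 1 (Set.Iic t)).toReal))) := by
  obtain ⟨δ, hδ, hint⟩ := hmom
  have hL2 (i : ℕ) : MemLp (X i) 2 μ := memLp_two_of_integrable_rpow (hmeas i) hδ (hint i)
  have hvar : Tendsto (fun n : ℕ => (∫ ω, (∑ i ∈ Finset.range n, X i ω) ^ 2 ∂μ) / n) atTop
      (𝓝 σ2) := hσ2 ▸ tendsto_integral_sum_range_sq_div hmeas hstat hdep hmean hL2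
  refine ⟨hvar, fun hσ t => ?_⟩
  have hpos : 0 < σ2 := Real.sqrt_pos.1 ((Real.sqrt_nonneg σ2).lt_of_ne hσ.symm)
  have hZ (n : ℕ) : Measurable
      fun ω => (∑ i ∈ Finset.range n, X i ω) / (Real.sqrt σ2 * Real.sqrt n) := by fun_prop
  let P (n : ℕ) : ProbabilityMeasure ℝ :=
    ⟨μ.map fun ω => (∑ i ∈ Finset.range n, X i ω) / (Real.sqrt σ2 * Real.sqrt n),
      Measure.isProbabilityMeasure_map (hZ n).aemeasurable⟩
  have hconv : Tendsto P atTop (𝓝 ⟨gaussianReal 0 1, inferInstance⟩) := by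
    refine ProbabilityMeasure.tendsto_iff_tendsto_charFun.2 fun s => ?_
    have h := tendsto_charFun_map_sum_range hmeas hstat hdep hmean hL2 hpos hvar
      ((Real.sqrt σ2)⁻¹ * s)
    have hlim : Complex.exp (-(((Real.sqrt σ2)⁻¹ * s) ^ 2 * σ2 / 2) : ℝ)
        = charFun (gaussianReal 0 1) s := by
      have hsq : ((Real.sqrt σ2)⁻¹ * s) ^ 2 * σ2 = s ^ 2 := by
        rw [mul_pow, inv_pow, Real.sq_sqrt hpos.le]
        field_simp
      rw [charFun_gaussianReal, hsq]
      simp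
    rw [hlim] at h
    refine h.congr fun n => ?_
    have hdiv : (fun ω => (∑ i ∈ Finset.range n, X i ω) / (Real.sqrt σ2 * Real.sqrt n))
        = fun ω => ((Real.sqrt n)⁻¹ * (Real.sqrt σ2)⁻¹) * ∑ i ∈ Finset.range n, X i ω := by
      ext ω
      rw [div_eq_mul_inv, mul_inv, mul_comm, mul_comm (Real.sqrt σ2)⁻¹]
    simp only [P, ProbabilityMeasure.coe_mk, hdiv]
    rw [charFun_map_mul_comp (by fun_prop), mul_assoc]
  have hset := ProbabilityMeasure.tendsto_measure_of_null_frontier_of_tendsto' hconv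
    (E := Set.Iic t) (by
      have := nullSingletonClass_gaussianReal (μ := 0) (v := 1) one_ne_zero
      simp)
  refine ((ENNReal.tendsto_toReal (measure_ne_top (gaussianReal 0 1) _)).comp hset).congr fun n => ?_
  simp only [P, ProbabilityMeasure.coe_mk, Function.comp_apply,
    Measure.map_apply (hZ n) measurableSet_Iic]
  rfl
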